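/- arXiv:math/0401235 — 2 statements merged into one kernel-verified Lean document; each statement's English description precedes it below -/
import Mathlib

section
/- Let n ≥ 1 and c ≥ 0 be integers. Then, in ℚ(q): Σ_{k=0}^{c} W_{n,c}(k) q^k = (−1)^{n−1} q^{−(n−1)(2c+n)/2} · [1;q]_{n−1}^2 · [c+1;q]_{2n−1} / [1;q]_{2n−1}. -/
open Finset

noncomputable def q : RatFunc ℚ := RatFunc.X

noncomputable def qb (a : ℤ) : RatFunc ℚ := (1 - q ^ a) / (1 - q)

noncomputable def qfac (a : ℤ) (n : ℕ) : RatFunc ℚ := ∏ i ∈ Finset.range n, qb (a + i)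

noncomputable def binq (n k : ℤ) : RatFunc ℚ :=
  if 0 ≤ k ∧ k ≤ n then qfac (n - k + 1) k.toNat / qfac 1 k.toNat else 0

noncomputable def Wnc (n c : ℕ) (k : ℤ) : RatFunc ℚ :=
  qfac (k + 1) (n - 1) * qfac (k - c - n + 1) (n - 1)

lemma q_ne_zero : q ≠ 0 := RatFunc.X_ne_zero

lemma one_sub_q_pow_succ_ne_zero (m : ℕ) : 1 - q ^ (m + 1) ≠ 0 := by
  intro h
  have h1 : (algebraMap (Polynomial ℚ) (RatFunc ℚ)) (Polynomial.X ^ (m + 1)) =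
      algebraMap (Polynomial ℚ) (RatFunc ℚ) 1 := by
    rw [map_pow, RatFunc.algebraMap_X, map_one]
    exact (sub_eq_zero.mp h).symm
  have h2 := congrArg Polynomial.natDegree (RatFunc.algebraMap_injective ℚ h1)
  simp at h2

lemma one_sub_q_ne_zero : 1 - q ≠ 0 := by
  simpa using one_sub_q_pow_succ_ne_zero 0

lemma qb_natCast (m : ℕ) : qb m = (1 - q ^ m) / (1 - q) := by
  simp [qb]

lemma qb_succ_ne_zero (m : ℕ) : qb ((m : ℤ) + 1) ≠ 0 := by
  have h := qb_natCast (m + 1)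
  push_cast at h
  rw [h]
  exact div_ne_zero (one_sub_q_pow_succ_ne_zero m) one_sub_q_ne_zero

lemma qb_add (a b : ℤ) : qb (a + b) = qb a + q ^ a * qb b := by
  have h := one_sub_q_ne_zero
  simp only [qb, zpow_add₀ q_ne_zero]
  field_simp
  ring

lemma qb_neg (a : ℤ) : qb (-a) = -1 * q ^ (-a) * qb a := by
  have h := qb_add (-a) a
  have h0 : qb 0 = 0 := by simp [qb]
  rw [neg_add_cancel, h0] at h
  linear_combination -h

lemma qfac_succ (a : ℤ) (n : ℕ) : qfac a (n + 1) = qfac a n * qb (a + n) :=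
  prod_range_succ _ _

lemma qfac_succ_left (a : ℤ) (n : ℕ) : qfac a (n + 1) = qb a * qfac (a + 1) n := by
  simp only [qfac, prod_range_succ']
  rw [mul_comm]
  congr 1
  · simp
  · refine prod_congr rfl fun i _ => ?_
    congr 1
    push_cast
    ring

lemma qfac_one_ne_zero (n : ℕ) : qfac 1 n ≠ 0 := by
  refine prod_ne_zero_iff.mpr fun i _ => ?_
  rw [add_comm]
  exact qb_succ_ne_zero i

/-- The Gaussian binomial coefficient `[c + a choose a]`. -/
noncomputable def gaussBinom (a c : ℕ) : RatFunc ℚ := qfac (c + 1) a / qfac 1 a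

lemma gaussBinom_zero_left (c : ℕ) : gaussBinom 0 c = 1 := by
  simp [gaussBinom, qfac]

lemma gaussBinom_zero_right (a : ℕ) : gaussBinom a 0 = 1 := by
  simp [gaussBinom, qfac_one_ne_zero]

lemma gaussBinom_succ_succ (a c : ℕ) :
    gaussBinom (a + 1) (c + 1) =
      gaussBinom a (c + 1) + q ^ (a + 1) * gaussBinom (a + 1) c := by
  have h1 := qfac_one_ne_zero a
  have h2 := qb_succ_ne_zero a
  have h3 := qb_add ((a : ℤ) + 1) (c + 1)
  have h4 : q ^ ((a : ℤ) + 1) = q ^ (a + 1) := by exact_mod_cast zpow_natCast q (a + 1)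
  rw [h4] at h3
  simp only [gaussBinom]
  rw [qfac_succ_left ((c : ℤ) + 1) a, qfac_succ 1 a, qfac_succ _ a]
  push_cast
  rw [show (c : ℤ) + 1 + 1 + a = a + 1 + (c + 1) by ring, h3, add_comm (1 : ℤ) a]
  field_simp

/-- The `q`-Vandermonde convolution. -/
lemma sum_gaussBinom_mul_gaussBinom (a b c : ℕ) :
    ∑ k ∈ range (c + 1), q ^ ((b + 1) * k) * gaussBinom a k * gaussBinom b (c - k) =
      gaussBinom (a + b + 1) c := by
  induction a generalizing c with
  | zero =>
    induction c with
    | zero => simp [gaussBinom_zero_right]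
    | succ c ih =>
      rw [sum_range_succ', zero_add, gaussBinom_succ_succ, ← zero_add b, ← ih, mul_sum,
        add_comm (gaussBinom _ _)]
      simp only [gaussBinom_zero_left, Nat.add_sub_add_right]
      congr 1
      · refine sum_congr rfl fun k _ => ?_
        rw [zero_add]
        ring
      · simp
  | succ a iha =>
    induction c with
    | zero => simp [gaussBinom_zero_right]
    | succ c ih =>
      rw [show a + 1 + b + 1 = (a + b + 1) + 1 by ring] at ih ⊢
      rw [gaussBinom_succ_succ, ← iha, ← ih, mul_sum, sum_range_succ', sum_range_succ' _ (c + 1)]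
      simp only [gaussBinom_succ_succ, Nat.add_sub_add_right, gaussBinom_zero_right]
      rw [add_right_comm, ← sum_add_distrib]
      congr 1
      refine sum_congr rfl fun k _ => ?_
      ring

lemma qfac_neg (m d : ℕ) :
    qfac (-(d : ℤ) - m) m =
      (-1) ^ m * q ^ (-((m : ℤ) * (2 * d + m + 1)) / 2) * qfac (d + 1) m := by
  induction m with
  | zero => simp [qfac]
  | succ m ih =>
    rw [qfac_succ_left, qfac_succ]
    push_cast
    rw [show -(d : ℤ) - (m + 1) + 1 = -d - m by ring, ih,
      show -(d : ℤ) - (m + 1) = -(d + 1 + m) by ring, qb_neg,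
      show -(((m : ℤ) + 1) * (2 * d + (m + 1) + 1)) / 2 =
        -(d + 1 + m) + -((m : ℤ) * (2 * d + m + 1)) / 2 by
        rw [show -(((m : ℤ) + 1) * (2 * d + (m + 1) + 1)) =
          -((m : ℤ) * (2 * d + m + 1)) + -(d + 1 + m) * 2 by ring,
          Int.add_mul_ediv_right _ _ two_ne_zero, add_comm],
      zpow_add₀ q_ne_zero]
    ring

lemma Wnc_mul_q_pow (m c k : ℕ) (hk : k ≤ c) :
    Wnc (m + 1) c k * q ^ k =
      (-1) ^ m * q ^ (-((m : ℤ) * (2 * c + (m + 1))) / 2) * qfac 1 m ^ 2 *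
        (q ^ ((m + 1) * k) * gaussBinom m k * gaussBinom m (c - k)) := by
  obtain ⟨d, rfl⟩ := Nat.exists_eq_add_of_le hk
  have h := qfac_one_ne_zero m
  have hexp : q ^ (-((m : ℤ) * (2 * d + m + 1)) / 2) =
      q ^ (-((m : ℤ) * (2 * (k + d) + (m + 1))) / 2) * q ^ (m * k) := by
    rw [← zpow_natCast q (m * k), ← zpow_add₀ q_ne_zero, ← Int.add_mul_ediv_right _ _ two_ne_zero]
    congr 2
    push_cast
    ring
  simp only [Wnc, gaussBinom, Nat.add_sub_cancel, Nat.add_sub_cancel_left]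
  push_cast
  rw [show (k : ℤ) - (k + d) - (m + 1) + 1 = -d - m by ring, qfac_neg, hexp]
  field_simp
  ring

/-- **Identity (12):** `Σ_{k=0}^{c} W_{n,c}(k) q^k
  = (-1)^{n-1} q^{-(n-1)(2c+n)/2} [1;q]_{n-1}^2 [c+1;q]_{2n-1} / [1;q]_{2n-1}`. -/
theorem statement16 (n c : ℕ) (hn : 1 ≤ n) :
    ∑ k ∈ Finset.range (c + 1), Wnc n c k * q ^ k =
      (-1 : RatFunc ℚ) ^ (n - 1) * q ^ (-(((n : ℤ) - 1) * (2 * c + n)) / 2) *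
        qfac 1 (n - 1) ^ 2 * qfac (c + 1) (2 * n - 1) / qfac 1 (2 * n - 1) := by
  obtain ⟨m, rfl⟩ := Nat.exists_eq_add_of_le' hn
  rw [sum_congr rfl fun k hk => Wnc_mul_q_pow m c k (Nat.lt_succ_iff.mp (mem_range.mp hk)),
    ← mul_sum, sum_gaussBinom_mul_gaussBinom, gaussBinom,
    show 2 * (m + 1) - 1 = m + m + 1 by omega, Nat.add_sub_cancel, mul_div_assoc]
  push_cast
  rw [add_sub_cancel_right]
end

section
/- Let n ≥ 1 and c ≥ 0 be integers. Then, in ℚ(q): Σ_{k=0}^{c} U_{n,c}(k) q^k = ( 2 / ( (∏_{i=0}^{n−2} (1−q^{2i+1})/(1−q^2)) · (1+q^{n−1})(1+q^n) ) ) · E, where E = ( ∏_{i=0}^{n−2} (1−q^{c+2+2i})/(1−q^2) )·(1+q^{c+n}) if c is even, and E = ( ∏_{i=0}^{n−1} (1−q^{c+1+2i})/(1−q^2) )·(1−q^2) if c is odd. -/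
open Finset

noncomputable def Unc (n c : ℕ) (k : ℤ) : RatFunc ℚ :=
  (-1 : RatFunc ℚ) ^ n * q ^ (((n : ℤ) - 1) * (2 * c + n) / 2) *
    (∑ i ∈ Finset.Icc 1 (n - 1),
      ((-1 : RatFunc ℚ) ^ c * q ^ (i * (i - 1) / 2) *
          (qfac (k + 1) (n - 1) * qfac (k - c - i + 1) (i - 1) *
            qfac (k - c - n + 1) (n - i - 1)) -
        q ^ (i * (i - 1) / 2) *
          (qfac (k + 1) (i - 1) * qfac (k + i + 1) (n - i - 1) *
            qfac (k - c - n + 1) (n - 1))) /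
      (qfac 1 (i - 1) * qfac 1 (n - 1 - i) * qfac (c + i + 1) (n - 1))) +
  (-1 : RatFunc ℚ) ^ k * q ^ (((n : ℤ) - 1) * k)

/-- The `t`-Pochhammer symbol `(z; t)_n`. -/
def qPoch {R : Type*} [CommRing R] (t z : R) (n : ℕ) : R := ∏ j ∈ range n, (1 - z * t ^ j)

section CommRing

variable {R : Type*} [CommRing R] (t z : R)

@[simp] lemma qPoch_zero : qPoch t z 0 = 1 := by simp [qPoch]

lemma qPoch_succ (n : ℕ) : qPoch t z (n + 1) = qPoch t z n * (1 - z * t ^ n) := by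
  simp [qPoch, prod_range_succ]

lemma qPoch_succ' (n : ℕ) : qPoch t z (n + 1) = (1 - z) * qPoch t (z * t) n := by
  simp only [qPoch, prod_range_succ', pow_zero, mul_one]
  rw [mul_comm]
  congr 1
  exact prod_congr rfl fun i _ => by ring

lemma qPoch_pascal (a k : ℕ) :
    qPoch t (t ^ (k + 2)) (a + 1) =
      (1 - t ^ (a + 1)) * qPoch t (t ^ (k + 2)) a + t ^ (a + 1) * qPoch t (t ^ (k + 1)) (a + 1) := by
  rw [qPoch_succ, qPoch_succ' t (t ^ (k + 1)), ← pow_succ]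
  ring

lemma qPoch_self_succ (a : ℕ) : qPoch t t (a + 1) = (1 - t ^ (a + 1)) * qPoch t t a := by
  rw [qPoch_succ]
  ring

/-- The `q`-Vandermonde convolution. -/
lemma qVandermonde (a b M : ℕ) :
    (∑ k ∈ range (M + 1), t ^ ((b + 1) * k) *
        (qPoch t (t ^ (k + 1)) a * qPoch t (t ^ (M - k + 1)) b)) * qPoch t t (a + b + 1) =
      qPoch t (t ^ (M + 1)) (a + b + 1) * (qPoch t t a * qPoch t t b) := by
  induction a generalizing M with
  | zero =>
    induction M with
    | zero => simp; ring
    | succ M ih =>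
      have h := qPoch_pascal t b M
      have hrec : ∑ k ∈ range (M + 1 + 1), t ^ ((b + 1) * k) *
            (qPoch t (t ^ (k + 1)) 0 * qPoch t (t ^ (M + 1 - k + 1)) b) =
          qPoch t (t ^ (M + 2)) b + t ^ (b + 1) * ∑ k ∈ range (M + 1), t ^ ((b + 1) * k) *
            (qPoch t (t ^ (k + 1)) 0 * qPoch t (t ^ (M - k + 1)) b) := by
        rw [sum_range_succ', add_comm, mul_sum]
        congr 1
        · simp
        · refine sum_congr rfl fun k _ => ?_
          rw [Nat.add_sub_add_right]
          simp only [qPoch_zero]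
          ring
      rw [hrec, add_mul, mul_assoc, ih, zero_add, h, qPoch_self_succ, qPoch_zero]
      ring
  | succ a iha =>
    induction M with
    | zero => simp; ring
    | succ M ih =>
      have h := qPoch_pascal t (a + b + 1) M
      have hrec : ∑ k ∈ range (M + 1 + 1), t ^ ((b + 1) * k) *
            (qPoch t (t ^ (k + 1)) (a + 1) * qPoch t (t ^ (M + 1 - k + 1)) b) =
          (1 - t ^ (a + 1)) * ∑ k ∈ range (M + 1 + 1), t ^ ((b + 1) * k) *
            (qPoch t (t ^ (k + 1)) a * qPoch t (t ^ (M + 1 - k + 1)) b) +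
          t ^ (a + b + 2) * ∑ k ∈ range (M + 1), t ^ ((b + 1) * k) *
            (qPoch t (t ^ (k + 1)) (a + 1) * qPoch t (t ^ (M - k + 1)) b) := by
        rw [sum_range_succ', sum_range_succ' _ (M + 1), mul_add, add_right_comm, mul_sum, mul_sum,
          ← sum_add_distrib]
        congr 1
        · refine sum_congr rfl fun k _ => ?_
          rw [Nat.add_sub_add_right, qPoch_pascal]
          ring
        · simp only [zero_add, pow_one, qPoch_self_succ]
          ring
      have e : a + 1 + b + 1 = a + b + 1 + 1 := by ring
      rw [e] at ih ⊢
      have iha' := iha (M + 1)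
      rw [qPoch_self_succ t (a + b + 1)] at ih ⊢
      rw [hrec, h]
      rw [qPoch_self_succ t a] at ih ⊢
      linear_combination (1 - t ^ (a + 1)) * (1 - t ^ (a + b + 1 + 1)) * iha' +
        t ^ (a + b + 2) * ih

end CommRing

section Field

variable {K : Type*} [Field K] {t : K}

lemma qPoch_self_ne_zero (ht : ∀ m : ℕ, t ^ (m + 1) ≠ 1) (n : ℕ) : qPoch t t n ≠ 0 := by
  refine prod_ne_zero_iff.2 fun j _ => sub_ne_zero.2 ?_
  rw [← pow_succ']
  exact (ht j).symm

lemma qPoch_ne_zero {y : K} (hy : ∀ j : ℕ, y * t ^ j ≠ 1) (r n : ℕ) :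
    qPoch t (y * t ^ r) n ≠ 0 := by
  refine prod_ne_zero_iff.2 fun j _ => sub_ne_zero.2 ?_
  rw [mul_assoc, ← pow_add]
  exact (hy _).symm

lemma kummer_partial (ht : ∀ m : ℕ, t ^ (m + 1) ≠ 1) {y : K} (hy : ∀ j : ℕ, y * t ^ j ≠ 1)
    (N m : ℕ) (hm : m ≤ N + 1) :
    ∑ r ∈ range m, ((1 - y * t ^ (2 * (N + 1))) * (1 - t ^ (N + 1)) *
          (t ^ (r + 1).choose 2 / (qPoch t t r * qPoch t t (N + 1 - r) * qPoch t (y * t ^ r) (N + 2)))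
        - (1 + t ^ (N + 1)) *
          (t ^ (r + 1).choose 2 / (qPoch t t r * qPoch t t (N - r) * qPoch t (y * t ^ r) (N + 1)))) =
      - t ^ (N + 1 - m) * t ^ (m + 1).choose 2 * (1 - t ^ m) /
        (qPoch t t m * qPoch t t (N + 1 - m) * qPoch t (y * t ^ m) (N + 1)) := by
  induction m with
  | zero => simp
  | succ m ih =>
    rw [sum_range_succ, ih (by omega)]
    obtain ⟨s, rfl⟩ : ∃ s, N = m + s := ⟨N - m, by omega⟩
    have e1 : m + s + 1 - m = s + 1 := by omega
    have e2 : m + s - m = s := by omega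
    have e3 : m + s + 1 - (m + 1) = s := by omega
    have e4 : (m + 1 + 1).choose 2 = (m + 1).choose 2 + (m + 1) := by
      rw [Nat.choose_succ_succ' (m + 1) 1, Nat.choose_one_right, add_comm]
    have h1 := qPoch_self_ne_zero ht m
    have h2 := qPoch_self_ne_zero ht s
    have h3 : (1 - t ^ (m + 1)) ≠ 0 := sub_ne_zero.2 (ht m).symm
    have h4 : (1 - t ^ (s + 1)) ≠ 0 := sub_ne_zero.2 (ht s).symm
    have h5 := qPoch_ne_zero hy (m + 1) (m + s)
    have h6 : (1 - y * t ^ m) ≠ 0 := sub_ne_zero.2 (hy m).symm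
    have h7 : (1 - y * t ^ (m + 1) * t ^ (m + s)) ≠ 0 := by
      rw [mul_assoc, ← pow_add]; exact sub_ne_zero.2 (hy _).symm
    have h8 : (1 - t ^ m * y) ≠ 0 := by rwa [mul_comm]
    rw [e1, e2, e3, e4, qPoch_succ' t (y * t ^ m), qPoch_succ' t (y * t ^ m), mul_assoc y, ← pow_succ,
      qPoch_succ t (y * t ^ (m + 1)), qPoch_self_succ, qPoch_self_succ]
    field_simp
    ring

/-- The terminating `q`-Kummer (Bailey–Daum) sum. -/
lemma kummer (ht : ∀ m : ℕ, t ^ (m + 1) ≠ 1) {y : K} (hy : ∀ j : ℕ, y * t ^ j ≠ 1) (N : ℕ) :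
    ∑ r ∈ range (N + 1),
        t ^ (r + 1).choose 2 / (qPoch t t r * qPoch t t (N - r) * qPoch t (y * t ^ r) (N + 1)) =
      qPoch t (-t) N / (qPoch t t N * ∏ j ∈ range (N + 1), (1 - y * t ^ (2 * j))) := by
  induction N with
  | zero => simp [qPoch_succ]
  | succ N ih =>
    have h := kummer_partial ht hy N (N + 1) le_rfl
    rw [sum_sub_distrib, ← mul_sum, ← mul_sum, ih] at h
    rw [sum_range_succ]
    have h1 := qPoch_self_ne_zero ht N
    have h3 : (1 - t ^ (N + 1)) ≠ 0 := sub_ne_zero.2 (ht N).symm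
    have h5 := qPoch_ne_zero hy (N + 1) (N + 1)
    have h6 : (1 - y * t ^ (2 * (N + 1))) ≠ 0 := sub_ne_zero.2 (hy _).symm
    have h7 : ∏ j ∈ range (N + 1), (1 - y * t ^ (2 * j)) ≠ 0 :=
      prod_ne_zero_iff.2 fun j _ => sub_ne_zero.2 (hy _).symm
    rw [prod_range_succ, qPoch_succ t (-t), qPoch_succ t _ (N + 1)]
    have e : 1 - y * t ^ (N + 1) * t ^ (N + 1) = 1 - y * t ^ (2 * (N + 1)) := by ring
    rw [Nat.sub_self, qPoch_zero, qPoch_self_succ, e]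
    rw [Nat.sub_self, qPoch_zero, qPoch_self_succ] at h
    rw [← eq_sub_iff_add_eq, ← mul_right_inj' (mul_ne_zero h6 h3)]
    rw [sub_eq_iff_eq_add] at h
    rw [h]
    field_simp
    ring

lemma prod_one_sub_inv (ht : t ≠ 0) {z : K} (hz : z ≠ 0) (m : ℕ) :
    ∏ s ∈ range m, (1 - (z * t ^ s)⁻¹) = (-1) ^ m * (z ^ m * t ^ m.choose 2)⁻¹ * qPoch t z m := by
  induction m with
  | zero => simp
  | succ m ih =>
    rw [prod_range_succ, ih, qPoch_succ, Nat.choose_succ_succ' m 1, Nat.choose_one_right]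
    field_simp
    ring

end Field

lemma prod_range_erase {M : Type*} [CommMonoid M] (f : ℕ → M) {N j : ℕ} (hj : j ≤ N) :
    ∏ s ∈ (range (N + 1)).erase j, f s =
      (∏ s ∈ range j, f s) * ∏ s ∈ range (N - j), f (j + 1 + s) := by
  obtain ⟨s, rfl⟩ := Nat.exists_eq_add_of_le hj
  have : (range (j + s + 1)).erase j = range j ∪ (Ico (j + 1) (j + s + 1)) := by
    ext x; simp; omega
  rw [this, prod_union, prod_Ico_eq_prod_range]
  · congr 2
    congr 1; omega
  · rw [disjoint_left]; intro x; simp; omega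

section Interpolation

open Polynomial

variable {K : Type*} [Field K] {t : K}

lemma prod_erase_left (ht0 : t ≠ 0) {N j : ℕ} (hj : j ≤ N) :
    ∏ s ∈ (range (N + 1)).erase j, (1 - t ^ s * (t ^ j)⁻¹) =
      (-1) ^ j * (t ^ (j + 1).choose 2)⁻¹ * (qPoch t t j * qPoch t t (N - j)) := by
  have h1 : ∏ s ∈ range j, (1 - t ^ s * (t ^ j)⁻¹) = ∏ s ∈ range j, (1 - (t * t ^ s)⁻¹) := by
    rw [← prod_range_reflect]
    refine prod_congr rfl fun s hs => ?_
    have hs := mem_range.1 hs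
    obtain ⟨m, rfl⟩ : ∃ m, j = m + s + 1 := ⟨j - s - 1, by omega⟩
    rw [show m + s + 1 - 1 - s = m by omega]
    field_simp
    ring
  have h2 : ∏ s ∈ range (N - j), (1 - t ^ (j + 1 + s) * (t ^ j)⁻¹) = qPoch t t (N - j) := by
    refine prod_congr rfl fun s _ => ?_
    field_simp
    ring
  rw [prod_range_erase _ hj, h1, h2, prod_one_sub_inv ht0 ht0, ← pow_add,
    Nat.choose_succ_succ' j 1, Nat.choose_one_right]
  ring

lemma prod_erase_right (ht0 : t ≠ 0) {N j : ℕ} (hj : j ≤ N) :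
    ∏ s ∈ (range (N + 1)).erase j, (1 - (t ^ s)⁻¹ * t ^ j) =
      (-1) ^ (N - j) * (t ^ (N - j + 1).choose 2)⁻¹ * (qPoch t t j * qPoch t t (N - j)) := by
  have h1 : ∏ s ∈ range j, (1 - (t ^ s)⁻¹ * t ^ j) = qPoch t t j := by
    rw [← prod_range_reflect, qPoch]
    refine prod_congr rfl fun s hs => ?_
    have hs := mem_range.1 hs
    obtain ⟨m, rfl⟩ : ∃ m, j = m + s + 1 := ⟨j - s - 1, by omega⟩
    rw [show m + s + 1 - 1 - s = m by omega]
    field_simp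
    ring
  have h2 : ∏ s ∈ range (N - j), (1 - (t ^ (j + 1 + s))⁻¹ * t ^ j) =
      ∏ s ∈ range (N - j), (1 - (t * t ^ s)⁻¹) := by
    refine prod_congr rfl fun s _ => ?_
    field_simp
    ring
  rw [prod_range_erase _ hj, h1, h2, prod_one_sub_inv ht0 ht0, ← pow_add,
    Nat.choose_succ_succ' (N - j) 1, Nat.choose_one_right]
  ring

lemma choose_two_add (j m : ℕ) :
    (j + m + 1).choose 2 = (j + 1).choose 2 + (m + 1).choose 2 + j * m := by
  induction m with
  | zero => simp
  | succ m ih =>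
    rw [← add_assoc, Nat.choose_succ_succ' (j + m + 1) 1, Nat.choose_succ_succ' (m + 1) 1, ih,
      Nat.choose_one_right, Nat.choose_one_right]
    ring

/-- The weights of the Lagrange interpolant `interp`. -/
def interpWeight (t : K) (N d r : ℕ) : K :=
  t ^ (r + 1).choose 2 / (qPoch t t r * qPoch t t (N - r) * qPoch t (t ^ (d + 1) * t ^ r) (N + 1))

/-- The polynomial of degree at most `2 * N + 1` which takes the value
`-(-1) ^ k * t ^ ((N + 1) * k)` at `t ^ k` for `-(N + 1) ≤ k ≤ -1` and for `d ≤ k ≤ d + N`. -/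
noncomputable def interp (t : K) (N d : ℕ) : K[X] :=
  C ((-1) ^ N * t ^ ((N + 1) * d + (N + 1).choose 2)) * ∑ r ∈ range (N + 1),
    C (interpWeight t N d r) *
      (C ((-1) ^ (d + 1)) * ((∏ s ∈ range (N + 1), (1 - C (t ^ (s + 1)) * X)) *
          ∏ s ∈ (range (N + 1)).erase r, (1 - C (t ^ (d + s))⁻¹ * X)) -
        (∏ s ∈ (range (N + 1)).erase r, (1 - C (t ^ (s + 1)) * X)) *
          ∏ s ∈ range (N + 1), (1 - C (t ^ (d + s))⁻¹ * X))

/-- The polynomial vanishing at the nodes common to `interp t N d` and `interp t N (d + 1)`. -/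
noncomputable def commonNodal (t : K) (N d : ℕ) : K[X] :=
  (∏ s ∈ range (N + 1), (1 - C (t ^ (s + 1)) * X)) *
    ∏ s ∈ range N, (1 - C (t ^ (d + 1 + s))⁻¹ * X)

lemma eval_interp (N d : ℕ) (x : K) : (interp t N d).eval x =
    (-1) ^ N * t ^ ((N + 1) * d + (N + 1).choose 2) * ∑ r ∈ range (N + 1),
      interpWeight t N d r *
        ((-1) ^ (d + 1) * ((∏ s ∈ range (N + 1), (1 - t ^ (s + 1) * x)) *
            ∏ s ∈ (range (N + 1)).erase r, (1 - (t ^ (d + s))⁻¹ * x)) -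
          (∏ s ∈ (range (N + 1)).erase r, (1 - t ^ (s + 1) * x)) *
            ∏ s ∈ range (N + 1), (1 - (t ^ (d + s))⁻¹ * x)) := by
  simp only [interp, eval_mul, eval_C, eval_finsetSum, eval_sub, eval_prod, eval_one, eval_X]

lemma eval_commonNodal (N d : ℕ) (x : K) : (commonNodal t N d).eval x =
    (∏ s ∈ range (N + 1), (1 - t ^ (s + 1) * x)) *
      ∏ s ∈ range N, (1 - (t ^ (d + 1 + s))⁻¹ * x) := by
  simp only [commonNodal, eval_mul, eval_C, eval_sub, eval_prod, eval_one, eval_X]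

lemma natDegree_prod_linear_le (s : Finset ℕ) (f : ℕ → K) :
    (∏ i ∈ s, (1 - C (f i) * X)).natDegree ≤ #s := by
  refine (natDegree_prod_le _ _).trans ?_
  refine (sum_le_card_nsmul _ _ 1 fun i _ => ?_).trans (by simp)
  compute_degree

lemma natDegree_interp_le (N d : ℕ) : (interp t N d).natDegree ≤ 2 * N + 1 := by
  refine (natDegree_C_mul_le _ _).trans (natDegree_sum_le_of_forall_le _ _ fun r hr => ?_)
  have hc : #((range (N + 1)).erase r) = N := by simp [card_erase_of_mem hr]
  have hm (f g : ℕ → K) (A B : Finset ℕ) (h : #A + #B = 2 * N + 1) :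
      ((∏ i ∈ A, (1 - C (f i) * X)) * ∏ i ∈ B, (1 - C (g i) * X)).natDegree ≤ 2 * N + 1 :=
    h ▸ natDegree_mul_le_of_le (natDegree_prod_linear_le _ _) (natDegree_prod_linear_le _ _)
  refine (natDegree_C_mul_le _ _).trans ((natDegree_sub_le_of_le
    ((natDegree_C_mul_le _ _).trans ?_) ?_).trans_eq (max_self (2 * N + 1)))
  · apply hm; rw [hc, card_range]; ring
  · apply hm; rw [hc, card_range]; ring

lemma natDegree_commonNodal_le (N d : ℕ) : (commonNodal t N d).natDegree ≤ 2 * N + 1 := by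
  have h := natDegree_mul_le_of_le
    (natDegree_prod_linear_le (range (N + 1)) fun s => t ^ (s + 1))
    (natDegree_prod_linear_le (range N) fun s => (t ^ (d + 1 + s))⁻¹)
  rw [card_range, card_range] at h
  exact h.trans (by omega)

lemma eval_interp_left (ht0 : t ≠ 0) (ht : ∀ m : ℕ, t ^ (m + 1) ≠ 1) (N d : ℕ) {j : ℕ}
    (hj : j ≤ N) :
    (interp t N d).eval (t ^ (j + 1))⁻¹ = (-1) ^ j * (t ^ ((N + 1) * (j + 1)))⁻¹ := by
  have hz : 1 - t ^ (j + 1) * (t ^ (j + 1))⁻¹ = 0 := by field_simp; simp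
  have hj' : j ∈ range (N + 1) := mem_range.2 (by omega)
  rw [eval_interp, prod_eq_zero hj' hz, sum_eq_single_of_mem j hj']
  · have h1 : ∏ s ∈ (range (N + 1)).erase j, (1 - t ^ (s + 1) * (t ^ (j + 1))⁻¹) =
        ∏ s ∈ (range (N + 1)).erase j, (1 - t ^ s * (t ^ j)⁻¹) := by
      refine prod_congr rfl fun s _ => ?_
      field_simp
      ring
    have h2 : ∏ s ∈ range (N + 1), (1 - (t ^ (d + s))⁻¹ * (t ^ (j + 1))⁻¹) =
        ∏ s ∈ range (N + 1), (1 - (t ^ (d + 1) * t ^ j * t ^ s)⁻¹) := by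
      refine prod_congr rfl fun s _ => ?_
      rw [← mul_inv]
      ring
    have h3 := qPoch_self_ne_zero ht j
    have h4 := qPoch_self_ne_zero ht (N - j)
    have h5 : qPoch t (t ^ (d + 1) * t ^ j) (N + 1) ≠ 0 :=
      qPoch_ne_zero (fun i => by rw [← pow_add, add_right_comm]; exact ht _) _ _
    rw [h1, h2, prod_erase_left ht0 hj, prod_one_sub_inv ht0 (mul_ne_zero (pow_ne_zero _ ht0) (pow_ne_zero _ ht0)), interpWeight]
    field_simp
    rcases neg_one_pow_eq_or K N with h | h <;> simp only [pow_succ, h] <;> ring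
  · intro r _ hr
    have h0 : ∏ s ∈ (range (N + 1)).erase r, (1 - t ^ (s + 1) * (t ^ (j + 1))⁻¹) = 0 :=
      prod_eq_zero (mem_erase.2 ⟨hr.symm, hj'⟩) hz
    rw [h0]
    ring

lemma eval_interp_right (ht0 : t ≠ 0) (ht : ∀ m : ℕ, t ^ (m + 1) ≠ 1) (N d : ℕ) {j : ℕ}
    (hj : j ≤ N) :
    (interp t N d).eval (t ^ (d + j)) = -(-1) ^ (d + j) * t ^ ((N + 1) * (d + j)) := by
  have hz : 1 - (t ^ (d + j))⁻¹ * t ^ (d + j) = 0 := by field_simp; simp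
  have hj' : j ∈ range (N + 1) := mem_range.2 (by omega)
  have hz' : ∏ s ∈ range (N + 1), (1 - (t ^ (d + s))⁻¹ * t ^ (d + j)) = 0 := prod_eq_zero hj' hz
  rw [eval_interp, hz', sum_eq_single_of_mem j hj']
  · have h1 : ∏ s ∈ (range (N + 1)).erase j, (1 - (t ^ (d + s))⁻¹ * t ^ (d + j)) =
        ∏ s ∈ (range (N + 1)).erase j, (1 - (t ^ s)⁻¹ * t ^ j) := by
      refine prod_congr rfl fun s _ => ?_
      field_simp
      ring
    have h2 : ∏ s ∈ range (N + 1), (1 - t ^ (s + 1) * t ^ (d + j)) =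
        qPoch t (t ^ (d + 1) * t ^ j) (N + 1) := by
      refine prod_congr rfl fun s _ => ?_
      ring
    have h3 := qPoch_self_ne_zero ht j
    have h4 := qPoch_self_ne_zero ht (N - j)
    have h5 : qPoch t (t ^ (d + 1) * t ^ j) (N + 1) ≠ 0 :=
      qPoch_ne_zero (fun i => by rw [← pow_add, add_right_comm]; exact ht _) _ _
    rw [h1, h2, prod_erase_right ht0 hj, interpWeight]
    obtain ⟨m, rfl⟩ := Nat.exists_eq_add_of_le hj
    rw [Nat.add_sub_cancel_left] at h4 ⊢
    have e : (j + 1).choose 2 + (j + 1).choose 2 = (j + 1) * j := by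
      have h := Nat.even_mul_succ_self j
      rw [Nat.choose_two_right, ← two_mul, Nat.add_sub_cancel, Nat.mul_div_cancel']
      exact mul_comm j _ ▸ h.two_dvd
    have e' : t ^ (j + 1).choose 2 * t ^ (j + 1).choose 2 = t ^ ((j + 1) * j) := by
      rw [← pow_add, e]
    rw [choose_two_add]
    field_simp
    rcases neg_one_pow_eq_or K m with h | h <;> simp only [pow_add, pow_one, h] <;>
      linear_combination -(t ^ ((j + m + 1) * d) * t ^ (m + 1).choose 2 * t ^ (j * m) * qPoch t t j *
        qPoch t t m * qPoch t (t ^ d * t * t ^ j) (j + m + 1) * (-1) ^ d * (-1) ^ j) * e'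
  · intro r _ hr
    have h0 : ∏ s ∈ (range (N + 1)).erase r, (1 - (t ^ (d + s))⁻¹ * t ^ (d + j)) = 0 :=
      prod_eq_zero (mem_erase.2 ⟨hr.symm, hj'⟩) hz
    rw [h0]
    ring

lemma eval_interp_zero (ht : ∀ m : ℕ, t ^ (m + 1) ≠ 1) (N d : ℕ) :
    (interp t N d).eval 0 = (-1) ^ N * t ^ ((N + 1) * d + (N + 1).choose 2) *
      ((qPoch t (-t) N / (qPoch t t N * ∏ j ∈ range (N + 1), (1 - t ^ (d + 1 + 2 * j)))) *
        ((-1) ^ (d + 1) - 1)) := by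
  have h := kummer ht (y := t ^ (d + 1))
    (fun i => by rw [← pow_add, add_right_comm]; exact ht _) N
  simp only [pow_add t (d + 1)]
  rw [← h, eval_interp, sum_mul]
  simp [interpWeight]

lemma eval_commonNodal_zero (N d : ℕ) : (commonNodal t N d).eval 0 = 1 := by
  simp [eval_commonNodal]

lemma zpow_injective_of_pow_ne_one (ht0 : t ≠ 0) (ht : ∀ m : ℕ, t ^ (m + 1) ≠ 1) :
    Function.Injective fun k : ℤ => t ^ k := by
  have key (a : ℤ) (m : ℕ) : t ^ (a + (m + 1 : ℕ)) ≠ t ^ a := by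
    rw [zpow_add₀ ht0, zpow_natCast]
    intro h
    exact ht m (mul_left_cancel₀ (zpow_ne_zero a ht0) (h.trans (mul_one _).symm))
  intro a b h
  rcases lt_trichotomy a b with hab | hab | hab
  · obtain ⟨m, hm⟩ := Int.eq_ofNat_of_zero_le (show 0 ≤ b - a - 1 by omega)
    refine absurd h.symm ?_
    convert key a m using 3
    push_cast; omega
  · exact hab
  · obtain ⟨m, hm⟩ := Int.eq_ofNat_of_zero_le (show 0 ≤ a - b - 1 by omega)
    refine absurd h ?_
    convert key b m using 3
    push_cast; omega

lemma interp_succ_sub (ht0 : t ≠ 0) (ht : ∀ m : ℕ, t ^ (m + 1) ≠ 1) (N d : ℕ) :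
    interp t N (d + 1) - interp t N d =
      C ((interp t N (d + 1)).eval 0 - (interp t N d).eval 0) * commonNodal t N d := by
  classical
  rw [← sub_eq_zero]
  set S : Finset K := insert 0
    ((Icc (-(N + 1) : ℤ) (-1) ∪ Icc (d + 1 : ℤ) (d + N)).image fun k : ℤ => t ^ k) with hS
  refine eq_zero_of_natDegree_lt_card_of_eval_eq_zero' _ S ?_ ?_
  · intro x hx
    rw [eval_sub, eval_sub, eval_mul, eval_C]
    simp only [hS, mem_insert, mem_image, mem_union, mem_Icc] at hx
    rcases hx with rfl | ⟨k, ⟨h1, h2⟩ | ⟨h1, h2⟩, rfl⟩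
    · rw [eval_commonNodal_zero]; ring
    · obtain ⟨j, hj⟩ := Int.eq_ofNat_of_zero_le (show 0 ≤ -1 - k by omega)
      obtain rfl : k = -((j + 1 : ℕ) : ℤ) := by push_cast; omega
      rw [zpow_neg, zpow_natCast, eval_interp_left ht0 ht _ _ (by omega),
        eval_interp_left ht0 ht _ _ (by omega), eval_commonNodal,
        prod_eq_zero (mem_range.2 (show j < N + 1 by omega))]
      · ring
      · field_simp; simp
    · obtain ⟨j, hj⟩ := Int.eq_ofNat_of_zero_le (show 0 ≤ k - d - 1 by omega)
      obtain rfl : k = ((d + 1 + j : ℕ) : ℤ) := by push_cast; omega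
      rw [zpow_natCast, eval_interp_right ht0 ht _ _ (by omega), add_assoc d,
        eval_interp_right ht0 ht _ _ (by omega), eval_commonNodal,
        prod_eq_zero (s := range N) (mem_range.2 (show j < N by omega))]
      · ring
      · rw [add_assoc]; field_simp; simp
  · have hcard : #S = 2 * N + 2 := by
      rw [hS, card_insert_of_notMem, card_image_of_injective _ (zpow_injective_of_pow_ne_one ht0 ht),
        card_union_of_disjoint, Int.card_Icc, Int.card_Icc]
      · omega
      · rw [disjoint_left]; intro x; simp only [mem_Icc]; omega
      · simp only [mem_image, not_exists, not_and]
        exact fun k _ => zpow_ne_zero k ht0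
    rw [hcard, Nat.lt_succ_iff]
    refine (natDegree_sub_le_of_le
      (natDegree_sub_le_of_le (natDegree_interp_le N (d + 1)) (natDegree_interp_le N d))
      ((natDegree_C_mul_le _ _).trans (natDegree_commonNodal_le N d))).trans_eq ?_
    rw [max_self, max_self]

lemma sum_eval_commonNodal (ht0 : t ≠ 0) (N d : ℕ) :
    (∑ k ∈ range (d + 1), (commonNodal t N d).eval (t ^ k) * t ^ k) * qPoch t t (2 * N + 2) =
      (-1) ^ N * (t ^ (N * d + (N + 1).choose 2))⁻¹ *
        (qPoch t (t ^ (d + 1)) (2 * N + 2) * (qPoch t t (N + 1) * qPoch t t N)) := by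
  have h := qVandermonde t (N + 1) N d
  rw [show N + 1 + N + 1 = 2 * N + 2 by ring] at h
  rw [← h, ← mul_assoc, mul_sum]
  congr 1
  refine sum_congr rfl fun k hk => ?_
  obtain ⟨e, rfl⟩ := Nat.exists_eq_add_of_le (Nat.lt_succ_iff.1 (mem_range.1 hk))
  have h1 : ∏ s ∈ range (N + 1), (1 - t ^ (s + 1) * t ^ k) = qPoch t (t ^ (k + 1)) (N + 1) :=
    prod_congr rfl fun s _ => by ring
  have h2 : ∏ s ∈ range N, (1 - (t ^ (k + e + 1 + s))⁻¹ * t ^ k) =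
      ∏ s ∈ range N, (1 - (t ^ (e + 1) * t ^ s)⁻¹) := by
    refine prod_congr rfl fun s _ => ?_
    field_simp
    ring
  rw [eval_commonNodal, h1, h2, prod_one_sub_inv ht0 (pow_ne_zero _ ht0), Nat.add_sub_cancel_left,
    Nat.choose_succ_succ' N 1, Nat.choose_one_right]
  field_simp
  ring

lemma qPoch_two_mul (z : K) (m : ℕ) : qPoch t z (2 * m) =
    (∏ i ∈ range m, (1 - z * t ^ (2 * i))) * ∏ i ∈ range m, (1 - z * t * t ^ (2 * i)) := by
  induction m with
  | zero => simp
  | succ m ih =>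
    rw [show 2 * (m + 1) = 2 * m + 1 + 1 by ring, qPoch_succ, qPoch_succ, ih, prod_range_succ,
      prod_range_succ]
    ring

lemma prod_one_sub_even (m : ℕ) :
    ∏ i ∈ range m, (1 - t * t * t ^ (2 * i)) = qPoch t t m * qPoch t (-t) m := by
  rw [qPoch, qPoch, ← prod_mul_distrib]
  exact prod_congr rfl fun i _ => by ring

lemma one_add_pow_ne_zero (ht : ∀ m : ℕ, t ^ (m + 1) ≠ 1) (m : ℕ) : 1 + t ^ (m + 1) ≠ 0 := by
  intro h
  apply ht (2 * m + 1)
  rw [show 2 * m + 1 + 1 = (m + 1) + (m + 1) by ring, pow_add, eq_neg_of_add_eq_zero_right h]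
  ring

/-- The sum over `0 ≤ k < d` of the interpolation errors, weighted by `t ^ k`. -/
noncomputable def errorSum (t : K) (N d : ℕ) : K :=
  ∑ k ∈ range d, ((interp t N d).eval (t ^ k) + (-1) ^ k * t ^ ((N + 1) * k)) * t ^ k

lemma errorSum_succ_sub (ht0 : t ≠ 0) (ht : ∀ m : ℕ, t ^ (m + 1) ≠ 1) (N d : ℕ) :
    errorSum t N (d + 1) - errorSum t N d =
      ((interp t N (d + 1)).eval 0 - (interp t N d).eval 0) *
        ∑ k ∈ range (d + 1), (commonNodal t N d).eval (t ^ k) * t ^ k := by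
  have h : errorSum t N d = ∑ k ∈ range (d + 1),
      ((interp t N d).eval (t ^ k) + (-1) ^ k * t ^ ((N + 1) * k)) * t ^ k := by
    have := eval_interp_right ht0 ht N d (Nat.zero_le N)
    rw [add_zero] at this
    rw [sum_range_succ, this, errorSum]
    ring
  rw [h, errorSum, ← sum_sub_distrib, mul_sum]
  refine sum_congr rfl fun k _ => ?_
  have h' := congrArg (eval (t ^ k)) (interp_succ_sub ht0 ht N d)
  rw [eval_sub, eval_mul, eval_C] at h'
  linear_combination t ^ k * h'

lemma errorSum_succ (ht0 : t ≠ 0) (ht : ∀ m : ℕ, t ^ (m + 1) ≠ 1) (N d : ℕ) :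
    errorSum t N (d + 1) = errorSum t N d +
      2 / ((∏ i ∈ range (N + 1), (1 - t ^ (2 * i + 1))) * (1 + t ^ (N + 1))) *
        (if Even d then t ^ d * ∏ i ∈ range (N + 1), (1 - t ^ (d + 2 + 2 * i))
        else -(t ^ (d + N + 1) * ∏ i ∈ range (N + 1), (1 - t ^ (d + 1 + 2 * i)))) := by
  have hne (e : ℕ) : ∏ i ∈ range (N + 1), (1 - t ^ (e + 1 + 2 * i)) ≠ 0 :=
    prod_ne_zero_iff.2 fun i _ => sub_ne_zero.2 <| by
      rw [add_right_comm]; exact (ht _).symm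
  have hA := hne d
  have hB := hne (d + 1)
  have hO := hne 0
  have h1 := qPoch_self_ne_zero ht N
  have h2 := qPoch_self_ne_zero ht (N + 1)
  have h3 := one_add_pow_ne_zero ht N
  have h4 := qPoch_self_ne_zero ht (2 * N + 2)
  have hs := sum_eval_commonNodal ht0 N d
  rw [← eq_div_iff h4] at hs
  have hq : qPoch t t (2 * N + 2) = (∏ i ∈ range (N + 1), (1 - t ^ (0 + 1 + 2 * i))) *
      (qPoch t t (N + 1) * (qPoch t (-t) N * (1 + t ^ (N + 1)))) := by
    rw [show 2 * N + 2 = 2 * (N + 1) by ring, qPoch_two_mul, prod_one_sub_even, qPoch_succ t (-t)]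
    congr 1
    · exact prod_congr rfl fun i _ => by ring
    · ring
  have hn : qPoch t (t ^ (d + 1)) (2 * N + 2) = (∏ i ∈ range (N + 1), (1 - t ^ (d + 1 + 2 * i))) *
      ∏ i ∈ range (N + 1), (1 - t ^ (d + 1 + 1 + 2 * i)) := by
    rw [show 2 * N + 2 = 2 * (N + 1) by ring, qPoch_two_mul]
    congr 1 <;> exact prod_congr rfl fun i _ => by ring
  have hO' : ∏ i ∈ range (N + 1), (1 - t ^ (2 * i + 1)) =
      ∏ i ∈ range (N + 1), (1 - t ^ (0 + 1 + 2 * i)) := prod_congr rfl fun i _ => by ring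
  have h5 : qPoch t (-t) N ≠ 0 := by
    intro h
    rw [hq, h] at h4
    simp at h4
  rw [← sub_eq_iff_eq_add', errorSum_succ_sub ht0 ht, hs, eval_interp_zero ht, eval_interp_zero ht,
    hO', hq, hn]
  split_ifs with hd
  · rw [hd.add_one.neg_one_pow, hd.add_one.add_one.neg_one_pow]
    rcases neg_one_pow_eq_or K N with h | h <;> rw [h] <;> field_simp <;> ring
  · rw [Nat.not_even_iff_odd] at hd
    rw [hd.add_one.neg_one_pow, hd.add_one.add_one.neg_one_pow]
    rcases neg_one_pow_eq_or K N with h | h <;> rw [h] <;> field_simp <;> ring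

lemma errorSum_eq (ht0 : t ≠ 0) (ht : ∀ m : ℕ, t ^ (m + 1) ≠ 1) (N d : ℕ) :
    errorSum t N d =
      2 / ((∏ i ∈ range (N + 1), (1 - t ^ (2 * i + 1))) * ((1 + t ^ (N + 1)) * (1 + t ^ (N + 2)))) *
        (if Even d then ∏ i ∈ range (N + 2), (1 - t ^ (d + 2 * i))
        else (∏ i ∈ range (N + 1), (1 - t ^ (d + 1 + 2 * i))) * (1 + t ^ (d + N + 1))) := by
  induction d with
  | zero =>
    rw [if_pos Even.zero, prod_eq_zero (mem_range.2 (Nat.succ_pos (N + 1))) (by simp)]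
    simp [errorSum]
  | succ d ih =>
    have h0 : ∏ i ∈ range (N + 1), (1 - t ^ (2 * i + 1)) ≠ 0 :=
      prod_ne_zero_iff.2 fun i _ => sub_ne_zero.2 (ht _).symm
    have h1 := one_add_pow_ne_zero ht N
    have h2 : 1 + t ^ (N + 2) ≠ 0 := one_add_pow_ne_zero ht (N + 1)
    rw [errorSum_succ ht0 ht, ih]
    by_cases hd : Even d
    · have hp : ∏ i ∈ range (N + 2), (1 - t ^ (d + 2 * i)) =
          (∏ i ∈ range (N + 1), (1 - t ^ (d + 2 + 2 * i))) * (1 - t ^ d) := by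
        rw [prod_range_succ']
        congr 1
        exact prod_congr rfl fun i _ => by ring
      rw [if_pos hd, if_pos hd, if_neg (Nat.not_even_iff_odd.2 hd.add_one), hp]
      field_simp
      ring
    · rw [if_neg hd, if_neg hd, if_pos (Nat.not_even_iff_odd.1 hd).add_one, prod_range_succ _ (N + 1)]
      field_simp
      ring

end Interpolation

lemma qfac_eq (a : ℤ) (m : ℕ) :
    qfac a m = (∏ j ∈ range m, (1 - q ^ a * q ^ j)) / (1 - q) ^ m := by
  have h : q ≠ 0 := RatFunc.X_ne_zero
  simp only [qfac, qb, prod_div_distrib, prod_const, card_range, zpow_add₀ h, zpow_natCast]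

lemma q_pow_ne_one (m : ℕ) : q ^ (m + 1) ≠ 1 := by
  intro h
  have h' : algebraMap (Polynomial ℚ) (RatFunc ℚ) (Polynomial.X ^ (m + 1)) =
      algebraMap (Polynomial ℚ) (RatFunc ℚ) 1 := by
    rw [map_pow, RatFunc.algebraMap_X, map_one]
    exact h
  have := congrArg Polynomial.natDegree (RatFunc.algebraMap_injective ℚ h')
  simp at this

lemma Unc_eq_interp (N c k : ℕ) : Unc (N + 2) c k =
    (interp q N (c + 1)).eval (q ^ k) + (-1) ^ k * q ^ ((N + 1) * k) := by
  have h0 : q ≠ 0 := RatFunc.X_ne_zero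
  have h1 : 1 - q ≠ 0 := sub_ne_zero.2 (by simpa using (q_pow_ne_one 0).symm)
  have hexp : ((N + 2 : ℕ) - 1 : ℤ) * (2 * c + (N + 2 : ℕ)) / 2 =
      ((N + 1) * (c + 1) + (N + 1).choose 2 : ℕ) := by
    refine Int.ediv_eq_of_eq_mul_left two_ne_zero ?_
    have h : (N + 1).choose 2 * 2 = (N + 1) * N := by
      rw [Nat.choose_two_right, Nat.add_sub_cancel, Nat.div_mul_cancel]
      exact mul_comm N _ ▸ (Nat.even_mul_succ_self N).two_dvd
    zify at h
    push_cast
    linear_combination -h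
  have hk : (-1 : RatFunc ℚ) ^ (k : ℤ) * q ^ (((N + 2 : ℕ) - 1 : ℤ) * k) =
      (-1) ^ k * q ^ ((N + 1) * k) := by
    rw [zpow_natCast, ← zpow_natCast q ((N + 1) * k)]
    congr 2
    push_cast
    ring
  have hI : Icc 1 (N + 2 - 1) = Ico 1 (N + 2) := by ext; simp; omega
  rw [Unc, hexp, hk, zpow_natCast, eval_interp, hI, sum_Ico_eq_sum_range]
  congr 2
  · ring
  refine sum_congr rfl fun r hr => ?_
  obtain ⟨m, rfl⟩ := Nat.exists_eq_add_of_le (Nat.lt_succ_iff.1 (mem_range.1 hr))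
  have hR : qfac (k - c - (1 + r : ℕ) + 1) r * qfac (k - c - (r + m + 2 : ℕ) + 1) m =
      (∏ s ∈ (range (r + m + 1)).erase r, (1 - (q ^ (c + 1 + s))⁻¹ * q ^ k)) /
        ((1 - q) ^ r * (1 - q) ^ m) := by
    rw [prod_range_erase _ (Nat.le_add_right r m), qfac_eq, qfac_eq, Nat.add_sub_cancel_left,
      div_mul_div_comm]
    congr 2
    · rw [← prod_range_reflect]
      refine prod_congr rfl fun s hs => ?_
      have hs := mem_range.1 hs
      obtain ⟨e, rfl⟩ : ∃ e, r = e + s + 1 := ⟨r - s - 1, by omega⟩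
      rw [show e + s + 1 - 1 - s = e by omega]
      simp only [← zpow_natCast, ← zpow_neg, ← zpow_add₀ h0]
      congr 2
      push_cast
      ring
    · rw [← prod_range_reflect]
      refine prod_congr rfl fun s hs => ?_
      have hs := mem_range.1 hs
      obtain ⟨e, rfl⟩ : ∃ e, m = e + s + 1 := ⟨m - s - 1, by omega⟩
      rw [show e + s + 1 - 1 - s = e by omega]
      simp only [← zpow_natCast, ← zpow_neg, ← zpow_add₀ h0]
      congr 2
      push_cast
      ring
  have hR' : qfac (k - c - (r + m + 2 : ℕ) + 1) (r + m + 1) =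
      (∏ s ∈ range (r + m + 1), (1 - (q ^ (c + 1 + s))⁻¹ * q ^ k)) / (1 - q) ^ (r + m + 1) := by
    rw [qfac_eq]
    congr 1
    rw [← prod_range_reflect]
    refine prod_congr rfl fun s hs => ?_
    have hs := mem_range.1 hs
    obtain ⟨e, he⟩ : ∃ e, r + m = e + s := ⟨r + m - s, by omega⟩
    rw [show r + m + 1 - 1 - s = e by omega]
    simp only [← zpow_natCast, ← zpow_neg, ← zpow_add₀ h0]
    congr 2
    zify at he
    push_cast
    linear_combination -he
  have hL : qfac (k + 1) r * qfac (k + (1 + r : ℕ) + 1) m =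
      (∏ s ∈ (range (r + m + 1)).erase r, (1 - q ^ (s + 1) * q ^ k)) /
        ((1 - q) ^ r * (1 - q) ^ m) := by
    rw [prod_range_erase _ (Nat.le_add_right r m), qfac_eq, qfac_eq, Nat.add_sub_cancel_left,
      div_mul_div_comm]
    congr 2 <;>
    · refine prod_congr rfl fun s _ => ?_
      simp only [← zpow_natCast, ← zpow_add₀ h0]
      congr 2
      push_cast
      ring
  have hL' : qfac (k + 1) (r + m + 1) =
      (∏ s ∈ range (r + m + 1), (1 - q ^ (s + 1) * q ^ k)) / (1 - q) ^ (r + m + 1) := by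
    rw [qfac_eq]
    congr 1
    refine prod_congr rfl fun s _ => ?_
    simp only [← zpow_natCast, ← zpow_add₀ h0]
    congr 2
    push_cast
    ring
  have hD (e : ℕ) : qfac 1 e = qPoch q q e / (1 - q) ^ e := by
    rw [qfac_eq, zpow_one, qPoch]
  have hD' : qfac (c + (1 + r : ℕ) + 1) (r + m + 1) =
      qPoch q (q ^ (c + 1 + 1) * q ^ r) (r + m + 1) / (1 - q) ^ (r + m + 1) := by
    rw [qfac_eq, qPoch]
    congr 1
    refine prod_congr rfl fun s _ => ?_
    simp only [← zpow_natCast, ← zpow_add₀ h0]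
    congr 2
    push_cast
    ring
  have e1 : r + m + 2 - 1 = r + m + 1 := by omega
  have e2 : 1 + r - 1 = r := by omega
  have e3 : r + m + 2 - (1 + r) - 1 = m := by omega
  have e4 : r + m + 1 - (1 + r) = m := by omega
  have e5 : (1 + r) * r / 2 = (r + 1).choose 2 := by
    rw [Nat.choose_two_right, add_comm, Nat.add_sub_cancel]
  have g1 := qPoch_self_ne_zero q_pow_ne_one r
  have g2 := qPoch_self_ne_zero q_pow_ne_one m
  have g3 : qPoch q (q ^ (c + 1 + 1) * q ^ r) (r + m + 1) ≠ 0 :=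
    qPoch_ne_zero (fun i => by rw [← pow_add, add_right_comm]; exact q_pow_ne_one _) _ _
  rw [e1, e2, e3, e4, e5, mul_assoc (qfac (k + 1) (r + m + 1)), hR, hR', hL, hL', hD, hD, hD',
    interpWeight, Nat.add_sub_cancel_left]
  generalize ∏ s ∈ range (r + m + 1), (1 - q ^ (s + 1) * q ^ k) = A
  generalize ∏ s ∈ range (r + m + 1), (1 - (q ^ (c + 1 + s))⁻¹ * q ^ k) = B
  generalize ∏ s ∈ (range (r + m + 1)).erase r, (1 - q ^ (s + 1) * q ^ k) = A'
  generalize ∏ s ∈ (range (r + m + 1)).erase r, (1 - (q ^ (c + 1 + s))⁻¹ * q ^ k) = B'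
  field_simp
  ring

/-- **Identity (17):** closed form for `Σ_{k=0}^{c} U_{n,c}(k) q^k`. -/
theorem statement19 (n c : ℕ) (hn : 1 ≤ n) :
    ∑ k ∈ Finset.range (c + 1), Unc n c k * q ^ k =
      2 / ((∏ i ∈ Finset.range (n - 1), (1 - q ^ (2 * i + 1)) / (1 - q ^ 2)) *
          ((1 + q ^ (n - 1)) * (1 + q ^ n))) *
      (if Even c then
        (∏ i ∈ Finset.range (n - 1), (1 - q ^ (c + 2 + 2 * i)) / (1 - q ^ 2)) *
          (1 + q ^ (c + n))
      else
        (∏ i ∈ Finset.range n, (1 - q ^ (c + 1 + 2 * i)) / (1 - q ^ 2)) * (1 - q ^ 2)) := by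
  have h2 : 1 - q ^ 2 ≠ 0 := sub_ne_zero.2 (q_pow_ne_one 1).symm
  have ha (m : ℕ) := one_add_pow_ne_zero q_pow_ne_one m
  obtain rfl | ⟨N, rfl⟩ : n = 1 ∨ ∃ N, n = N + 2 := by
    rcases n with _ | _ | N
    · omega
    · exact Or.inl rfl
    · exact Or.inr ⟨N, rfl⟩
  · have h1 : 1 + q ≠ 0 := by simpa using ha 0
    have hU (k : ℕ) : Unc 1 c k * q ^ k = (-q) ^ k := by
      simp [Unc, neg_pow q]
    have hg := mul_neg_geom_sum (-q) (c + 1)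
    rw [sub_neg_eq_add] at hg
    simp only [hU]
    rw [← mul_right_inj' h1, hg]
    split_ifs with hc
    · rw [hc.add_one.neg_pow]
      simp
      field_simp
      norm_num
    · rw [(Nat.not_even_iff_odd.1 hc).add_one.neg_pow]
      simp
      field_simp
      norm_num
  · have h0 : ∏ i ∈ range (N + 1), (1 - q ^ (2 * i + 1)) ≠ 0 :=
      prod_ne_zero_iff.2 fun i _ => sub_ne_zero.2 (q_pow_ne_one _).symm
    have h3 : 1 + q ^ (N + 1) ≠ 0 := ha N
    have h4 : 1 + q ^ (N + 2) ≠ 0 := ha (N + 1)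
    have hS : ∑ k ∈ range (c + 1), Unc (N + 2) c k * q ^ k = errorSum q N (c + 1) :=
      sum_congr rfl fun k _ => by rw [Unc_eq_interp]
    rw [hS, errorSum_eq RatFunc.X_ne_zero q_pow_ne_one, show N + 2 - 1 = N + 1 by omega]
    simp only [prod_div_distrib, prod_const, card_range, Nat.even_add_one]
    split_ifs with hc
    · rw [show c + 1 + N + 1 = c + (N + 2) by ring]
      field_simp
    · field_simp
      ring
end
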